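/- arXiv:2206.12970 — 5 statements merged into one kernel-verified Lean document; each statement's English description precedes it below -/
import Mathlib

section
/- Let π₁, π₂ be checking sequences and let π₃ be a finite sequence of instructions that is appendable to both π₁ and π₂ (i.e., both concatenations π₁ ∘ π₃ and π₂ ∘ π₃ are checking sequences). If λ(π₁) ≤ λ(π₂), then U(π₁ ∘ π₃) − U(π₁) ≤ U(π₂ ∘ π₃) − U(π₂). -/
noncomputable section

/-- Parameters of the cost-asymmetric memory-hard password hashing model:
`n` passwords with probabilities `p 1 >= ... >= p n`, `m` breakpoints with
probabilities `q 1, ..., q m`, running-time breakpoints `t 0 < t 1 < ... < t m`,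
memory-cost constant `cM` and password value `v`. -/
structure Params where
  n : ℕ
  m : ℕ
  p : ℕ → ℝ
  q : ℕ → ℝ
  t : ℕ → ℝ
  cM : ℝ
  v : ℝ

namespace Params

/-- The standing hypotheses on the parameters. -/
structure Hyp (P : Params) : Prop where
  hn : 1 ≤ P.n
  hm : 1 ≤ P.m
  p_pos : ∀ i ∈ Finset.Icc 1 P.n, 0 < P.p i
  p_anti : ∀ i ∈ Finset.Icc 1 P.n, ∀ i' ∈ Finset.Icc 1 P.n, i ≤ i' → P.p i' ≤ P.p i
  p_sum : ∑ i ∈ Finset.Icc 1 P.n, P.p i ≤ 1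
  q_nonneg : ∀ j ∈ Finset.Icc 1 P.m, 0 ≤ P.q j
  q_sum : ∑ j ∈ Finset.Icc 1 P.m, P.q j = 1
  t_zero : P.t 0 = 0
  t_mono : ∀ j j', j < j' → j' ≤ P.m → P.t j < P.t j'
  cM_pos : 0 < P.cM
  v_pos : 0 < P.v

/-- Probability `Pr[(i, j)] = p i * q j` of an instruction. -/
def pr (P : Params) (e : ℕ × ℕ) : ℝ := P.p e.1 * P.q e.2

/-- Round cost `c(i, j) = cM * (t j ^ 2 - t (j-1) ^ 2)` of an instruction. -/
def rcost (P : Params) (e : ℕ × ℕ) : ℝ := P.cM * (P.t e.2 ^ 2 - P.t (e.2 - 1) ^ 2)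

/-- `λ` of a finite sequence of instructions: the sum of their probabilities. -/
def lamL (P : Params) (L : List (ℕ × ℕ)) : ℝ := (L.map P.pr).sum

/-- Expected guessing cost of executing the instructions of `L` sequentially,
`μ` being the probability mass already eliminated. -/
def costAux (P : Params) : ℝ → List (ℕ × ℕ) → ℝ
  | _, [] => 0
  | μ, e :: L => P.rcost e * (1 - μ) + P.costAux (μ + P.pr e) L

/-- Attacker's utility `U(π) = v·λ(π) - Σ_k c(π_k)·(1 - λ(π, k-1))` of a finite
sequence of instructions. -/
def UL (P : Params) (L : List (ℕ × ℕ)) : ℝ := P.v * P.lamL L - P.costAux 0 L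

/-- The block of instructions `ϖ_i(j₁, j₂) = (i, j₁), (i, j₁+1), ..., (i, j₂)`. -/
def iBlock (i j₁ j₂ : ℕ) : List (ℕ × ℕ) :=
  (List.range (j₂ + 1 - j₁)).map fun k => (i, j₁ + k)

/-- The checking sequence `ϖ_1(1, τ 1) ∘ ... ∘ ϖ_n(1, τ n)` determined by the
exponent vector `τ`. -/
def seqOf (P : Params) (τ : ℕ → ℕ) : List (ℕ × ℕ) :=
  ((List.range P.n).map fun i => iBlock (i + 1) 1 (τ (i + 1))).foldr (· ++ ·) []

/-- `L` is a checking sequence. -/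
def IsCheckSeq (P : Params) (L : List (ℕ × ℕ)) : Prop :=
  ∃ τ : ℕ → ℕ, (∀ i, τ i ≤ P.m) ∧ L = P.seqOf τ

theorem costAux_append (P : Params) (μ : ℝ) (L L' : List (ℕ × ℕ)) :
    P.costAux μ (L ++ L') = P.costAux μ L + P.costAux (μ + P.lamL L) L' := by
  induction L generalizing μ with
  | nil => simp [costAux, lamL]
  | cons e L ih =>
    simp only [List.cons_append, costAux, ih, lamL, List.map_cons, List.sum_cons, add_assoc]

theorem lamL_append (P : Params) (L L' : List (ℕ × ℕ)) :
    P.lamL (L ++ L') = P.lamL L + P.lamL L' := by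
  simp [lamL]

/-- The utility gained by appending `L'` to `L` depends on `L` only through `λ(L)`. -/
theorem UL_append_sub_UL (P : Params) (L L' : List (ℕ × ℕ)) :
    P.UL (L ++ L') - P.UL L = P.v * P.lamL L' - P.costAux (P.lamL L) L' := by
  simp only [UL, lamL_append, costAux_append, zero_add]
  ring

theorem costAux_antitone (P : Params) {L : List (ℕ × ℕ)} (hL : ∀ e ∈ L, 0 ≤ P.rcost e) :
    Antitone fun μ => P.costAux μ L := by
  induction L with
  | nil => exact antitone_const
  | cons e L ih =>
    intro μ ν h
    have hhead : P.rcost e * (1 - ν) ≤ P.rcost e * (1 - μ) :=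
      mul_le_mul_of_nonneg_left (by linarith) (hL e List.mem_cons_self)
    have htail := ih (fun e' he' => hL e' (List.mem_cons_of_mem _ he'))
      (add_le_add_left h (P.pr e))
    exact add_le_add hhead htail

theorem IsCheckSeq.snd_le {P : Params} {L : List (ℕ × ℕ)} (hL : P.IsCheckSeq L)
    {e : ℕ × ℕ} (he : e ∈ L) : 1 ≤ e.2 ∧ e.2 ≤ P.m := by
  obtain ⟨τ, hτ, rfl⟩ := hL
  have hflat : ∀ M : List (List (ℕ × ℕ)), M.foldr (· ++ ·) [] = M.flatten := fun M => by
    induction M with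
    | nil => rfl
    | cons a M ih => simp [ih]
  rw [seqOf, hflat, List.mem_flatten] at he
  obtain ⟨l, hl, hel⟩ := he
  obtain ⟨i, -, rfl⟩ := List.mem_map.1 hl
  obtain ⟨k, hk, rfl⟩ := List.mem_map.1 hel
  have hk := List.mem_range.1 hk
  have hi := hτ (i + 1)
  constructor <;> dsimp only <;> omega

theorem Hyp.rcost_nonneg {P : Params} (hP : P.Hyp) {e : ℕ × ℕ} (h1 : 1 ≤ e.2)
    (hm : e.2 ≤ P.m) : 0 ≤ P.rcost e := by
  have hlt : P.t (e.2 - 1) < P.t e.2 := hP.t_mono _ _ (by omega) hm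
  have hnonneg : 0 ≤ P.t (e.2 - 1) := by
    rcases Nat.eq_zero_or_pos (e.2 - 1) with h | h
    · rw [h, hP.t_zero]
    · exact hP.t_zero ▸ (hP.t_mono 0 _ h (by omega)).le
  exact mul_nonneg hP.cM_pos.le (sub_nonneg.2 (pow_le_pow_left₀ hnonneg hlt.le 2))

/-- if `π₃` is appendable to the checking sequences `π₁` and `π₂`
and `λ(π₁) ≤ λ(π₂)`, then `U(π₁ ∘ π₃) - U(π₁) ≤ U(π₂ ∘ π₃) - U(π₂)`. -/
theorem statement0 (P : Params) (hP : P.Hyp) (π₁ π₂ π₃ : List (ℕ × ℕ))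
    (h₁ : P.IsCheckSeq π₁) (h₂ : P.IsCheckSeq π₂)
    (h₁₃ : P.IsCheckSeq (π₁ ++ π₃)) (h₂₃ : P.IsCheckSeq (π₂ ++ π₃))
    (hlam : P.lamL π₁ ≤ P.lamL π₂) :
    P.UL (π₁ ++ π₃) - P.UL π₁ ≤ P.UL (π₂ ++ π₃) - P.UL π₂ := by
  rw [UL_append_sub_UL, UL_append_sub_UL]
  refine sub_le_sub_left (P.costAux_antitone (fun e he => ?_) hlam) _
  obtain ⟨h1, hm⟩ := h₁₃.snd_le (List.mem_append_right π₁ he)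
  exact hP.rcost_nonneg h1 hm

end Params
end
end

section
/- Let π be a checking sequence with exponent vector τ, fix i with τ_i < m, and let e be the single-instruction block ϖ_i(τ_i+1, τ_i+1), i.e., the instruction (i, τ_i+1). Then U(π ∪ e) − U(π) = p_i·q_{τ_i+1}·(v + Σ_{e′ ∈ π, e′ > e} c(e′)) − (1 − Σ_{e′ ∈ π, e′ < e} Pr[e′])·c(i, τ_i+1), where the sums range over the instructions e′ of π that come after (respectively before) e in the natural ordering. -/
noncomputable section

namespace Params

/-- Cumulative breakpoint probability `Q j = q 1 + ... + q j`. -/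
def Q (P : Params) (j : ℕ) : ℝ := ∑ j' ∈ Finset.Icc 1 j, P.q j'

/-- Round cost `c(i, j) = cM * (t j ^ 2 - t (j-1) ^ 2)` of executing an
instruction with label index `j` (it does not depend on the password index). -/
def rc (P : Params) (j : ℕ) : ℝ := P.cM * (P.t j ^ 2 - P.t (j - 1) ^ 2)

/-- A checking sequence is determined by its exponent vector `τ`: for each
password `i ∈ [1, n]` the attacker executes the instructions
`(i, 1), ..., (i, τ i)`, passwords being processed in increasing order.
`τ` is valid if `τ i ≤ m` for all `i` and `τ i = 0` outside `[1, n]`. -/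
def Valid (P : Params) (τ : ℕ → ℕ) : Prop :=
  (∀ i, τ i ≤ P.m) ∧ ∀ i, i ∉ Finset.Icc 1 P.n → τ i = 0

/-- Success probability `λ(π)` of the checking sequence with exponent vector `τ`. -/
def lam (P : Params) (τ : ℕ → ℕ) : ℝ := ∑ i ∈ Finset.Icc 1 P.n, P.p i * P.Q (τ i)

/-- Probability mass `λ(π, k-1)` of the instructions strictly preceding the
instruction `(i, j)` in the checking sequence with exponent vector `τ`. -/
def lamBefore (P : Params) (τ : ℕ → ℕ) (i j : ℕ) : ℝ :=
  (∑ i' ∈ Finset.Ico 1 i, P.p i' * P.Q (τ i')) + P.p i * P.Q (j - 1)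

/-- Attacker's utility `U(π) = v·λ(π) - Σ_k c(π_k)·(1 - λ(π, k-1))`. -/
def U (P : Params) (τ : ℕ → ℕ) : ℝ :=
  P.v * P.lam τ -
    ∑ i ∈ Finset.Icc 1 P.n, ∑ j ∈ Finset.Icc 1 (τ i), P.rc j * (1 - P.lamBefore τ i j)

/-- A checking sequence is optimal if it maximizes the attacker's utility. -/
def Optimal (P : Params) (τ : ℕ → ℕ) : Prop :=
  P.Valid τ ∧ ∀ τ', P.Valid τ' → P.U τ' ≤ P.U τ

/-- `π ⊆ π'` for checking sequences: `τ i ≤ τ' i` for all `i`. -/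
def Subseq (P : Params) (τ τ' : ℕ → ℕ) : Prop := ∀ i, τ i ≤ τ' i

/-- Splitting a sum over `[1, n]` at an index `i` of the interval. -/
theorem sum_Icc_one_split {n i : ℕ} (hi : i ∈ Finset.Icc 1 n) (f : ℕ → ℝ) :
    ∑ k ∈ Finset.Icc 1 n, f k =
      ∑ k ∈ Finset.Ico 1 i, f k + f i + ∑ k ∈ Finset.Icc (i + 1) n, f k := by
  obtain ⟨h1, h2⟩ := Finset.mem_Icc.mp hi
  rw [← Finset.Ico_add_one_right_eq_Icc, ← Finset.Ico_add_one_right_eq_Icc,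
    ← Finset.sum_Ico_succ_top h1, Finset.sum_Ico_consecutive _ (by omega) (by omega)]

theorem Q_succ (P : Params) (j : ℕ) : P.Q (j + 1) = P.Q j + P.q (j + 1) :=
  Finset.sum_Icc_succ_top (by omega) _

theorem lam_update (P : Params) (τ : ℕ → ℕ) {i : ℕ} (hi : i ∈ Finset.Icc 1 P.n) :
    P.lam (Function.update τ i (τ i + 1)) = P.lam τ + P.p i * P.q (τ i + 1) := by
  unfold lam
  rw [← Finset.add_sum_erase _ _ hi, ← Finset.add_sum_erase _ (fun k => P.p k * P.Q (τ k)) hi,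
    Finset.sum_congr rfl fun k hk => by
      rw [Function.update_of_ne (Finset.ne_of_mem_erase hk)]]
  rw [Function.update_self, Q_succ]
  ring

theorem lamBefore_update_of_le (P : Params) (τ : ℕ → ℕ) {i k : ℕ} (h : k ≤ i) (j : ℕ) :
    P.lamBefore (Function.update τ i (τ i + 1)) k j = P.lamBefore τ k j := by
  unfold lamBefore
  congr 1
  refine Finset.sum_congr rfl fun l hl => ?_
  rw [Function.update_of_ne (by have := Finset.mem_Ico.mp hl; omega)]

theorem lamBefore_update_of_lt (P : Params) (τ : ℕ → ℕ) {i k : ℕ} (hi : 1 ≤ i) (h : i < k)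
    (j : ℕ) :
    P.lamBefore (Function.update τ i (τ i + 1)) k j =
      P.lamBefore τ k j + P.p i * P.q (τ i + 1) := by
  have hmem : i ∈ Finset.Ico 1 k := Finset.mem_Ico.mpr ⟨hi, h⟩
  unfold lamBefore
  rw [← Finset.add_sum_erase _ _ hmem,
    ← Finset.add_sum_erase _ (fun k => P.p k * P.Q (τ k)) hmem,
    Finset.sum_congr rfl fun k hk => by
      rw [Function.update_of_ne (Finset.ne_of_mem_erase hk)]]
  rw [Function.update_self, Q_succ]
  ring

/-- the marginal utility of inserting the single instruction
`(i, τ i + 1)` into the checking sequence `τ`. -/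
theorem statement1 (P : Params) (hP : P.Hyp) (τ : ℕ → ℕ) (hτ : P.Valid τ)
    (i : ℕ) (hi : i ∈ Finset.Icc 1 P.n) (hτi : τ i < P.m) :
    P.U (Function.update τ i (τ i + 1)) - P.U τ =
      P.p i * P.q (τ i + 1) *
          (P.v + ∑ i' ∈ Finset.Icc (i + 1) P.n, ∑ j' ∈ Finset.Icc 1 (τ i'), P.rc j') -
        (1 - ((∑ i' ∈ Finset.Ico 1 i, ∑ j' ∈ Finset.Icc 1 (τ i'), P.p i' * P.q j') +
              ∑ j' ∈ Finset.Icc 1 (τ i), P.p i * P.q j')) * P.rc (τ i + 1) := by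
  have hbefore : (∑ i' ∈ Finset.Ico 1 i, ∑ j' ∈ Finset.Icc 1 (τ i'), P.p i' * P.q j') +
      ∑ j' ∈ Finset.Icc 1 (τ i), P.p i * P.q j' = P.lamBefore τ i (τ i + 1) := by
    simp only [lamBefore, Q, ← Finset.mul_sum, Nat.add_sub_cancel]
  have hlt : ∑ k ∈ Finset.Ico 1 i, ∑ j ∈ Finset.Icc 1 (Function.update τ i (τ i + 1) k),
        P.rc j * (1 - P.lamBefore (Function.update τ i (τ i + 1)) k j) =
      ∑ k ∈ Finset.Ico 1 i, ∑ j ∈ Finset.Icc 1 (τ k), P.rc j * (1 - P.lamBefore τ k j) := by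
    refine Finset.sum_congr rfl fun k hk => ?_
    have hki := (Finset.mem_Ico.mp hk).2
    simp only [Function.update_of_ne hki.ne, lamBefore_update_of_le P τ hki.le]
  have hgt : ∑ k ∈ Finset.Icc (i + 1) P.n,
        ∑ j ∈ Finset.Icc 1 (Function.update τ i (τ i + 1) k),
          P.rc j * (1 - P.lamBefore (Function.update τ i (τ i + 1)) k j) =
      ∑ k ∈ Finset.Icc (i + 1) P.n, ∑ j ∈ Finset.Icc 1 (τ k), P.rc j * (1 - P.lamBefore τ k j) -
        P.p i * P.q (τ i + 1) *
          ∑ k ∈ Finset.Icc (i + 1) P.n, ∑ j ∈ Finset.Icc 1 (τ k), P.rc j := by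
    simp only [Finset.mul_sum, ← Finset.sum_sub_distrib]
    refine Finset.sum_congr rfl fun k hk => ?_
    have hik : i < k := (Finset.mem_Icc.mp hk).1
    rw [Function.update_of_ne hik.ne']
    refine Finset.sum_congr rfl fun j _ => ?_
    rw [lamBefore_update_of_lt P τ (Finset.mem_Icc.mp hi).1 hik]
    ring
  rw [hbefore]
  unfold U
  rw [lam_update P τ hi, sum_Icc_one_split hi, sum_Icc_one_split hi, hlt, hgt]
  simp only [Function.update_self, lamBefore_update_of_le P τ le_rfl]
  rw [Finset.sum_Icc_succ_top (by omega)]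
  ring

end Params
end
end

section
/- Let π be a checking sequence and let S = {e_1 < e_2 < … < e_b} be a set of blocks addable to π with pairwise distinct password indices, listed in natural ordering. Then U(π ∪ S) − U(π) = Σ_{l=1}^{b} Δ(e_l | π) + Σ_{l=1}^{b} c(e_l)·(Σ_{l′ < l} Pr[e_{l′}]). -/
noncomputable section

namespace Params

/-- The utility as a sum over passwords, with the interaction between distinct passwords
separated from the terms that involve a single password. -/
theorem U_eq_sum (P : Params) (τ : ℕ → ℕ) :
    P.U τ = ∑ i ∈ Finset.Icc 1 P.n,
      ((P.v * (P.p i * P.Q (τ i)) -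
          ∑ j ∈ Finset.Icc 1 (τ i), P.rc j * (1 - P.p i * P.Q (j - 1))) +
        (∑ j ∈ Finset.Icc 1 (τ i), P.rc j) * ∑ i' ∈ Finset.Ico 1 i, P.p i' * P.Q (τ i')) := by
  unfold U lam lamBefore
  rw [Finset.mul_sum, ← Finset.sum_sub_distrib]
  refine Finset.sum_congr rfl fun i _ => ?_
  rw [Finset.sum_mul, sub_add, ← Finset.sum_sub_distrib]
  congr 1
  exact Finset.sum_congr rfl fun j _ => by ring

/-- Replacing the exponent of one password changes a sum over `Ico 1 i` only if the index lies below `i`. -/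
theorem sum_Ico_update (L : ℕ → ℕ → ℝ) (τ : ℕ → ℕ) {a : ℕ} (ha : 1 ≤ a) (s i : ℕ) :
    ∑ k ∈ Finset.Ico 1 i, L k (Function.update τ a s k) =
      ∑ k ∈ Finset.Ico 1 i, L k (τ k) + if a < i then L a s - L a (τ a) else 0 := by
  rw [← sub_eq_iff_eq_add', ← Finset.sum_sub_distrib]
  have h : ∀ k ∈ Finset.Ico 1 i, L k (Function.update τ a s k) - L k (τ k) =
      if k = a then L a s - L a (τ a) else 0 := by
    intro k _
    by_cases hk : k = a
    · subst hk; simp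
    · simp [hk]
  rw [Finset.sum_congr rfl h, Finset.sum_ite_eq']
  simp [ha]

/-- Marginal utility of changing the exponent of a single password. -/
theorem U_update_sub (P : Params) (τ : ℕ → ℕ) {a : ℕ} (ha : a ∈ Finset.Icc 1 P.n) (s : ℕ) :
    P.U (Function.update τ a s) - P.U τ =
      (P.v * (P.p a * P.Q s) - ∑ j ∈ Finset.Icc 1 s, P.rc j * (1 - P.p a * P.Q (j - 1))) -
        (P.v * (P.p a * P.Q (τ a)) -
          ∑ j ∈ Finset.Icc 1 (τ a), P.rc j * (1 - P.p a * P.Q (j - 1))) +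
        (∑ j ∈ Finset.Icc 1 s, P.rc j - ∑ j ∈ Finset.Icc 1 (τ a), P.rc j) *
          ∑ i' ∈ Finset.Ico 1 a, P.p i' * P.Q (τ i') +
        ∑ i ∈ Finset.Icc 1 P.n, if a < i then
          (∑ j ∈ Finset.Icc 1 (τ i), P.rc j) * (P.p a * P.Q s - P.p a * P.Q (τ a)) else 0 := by
  have ha1 := (Finset.mem_Icc.mp ha).1
  rw [U_eq_sum, U_eq_sum, ← Finset.sum_sub_distrib, ← sub_eq_iff_eq_add,
    ← Finset.sum_sub_distrib]
  rw [Finset.sum_eq_single_of_mem a ha]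
  · rw [sum_Ico_update (fun k x => P.p k * P.Q x) τ ha1]
    simp only [Function.update_self, lt_irrefl, if_false]
    ring
  · intro i _ hi
    rw [sum_Ico_update (fun k x => P.p k * P.Q x) τ ha1]
    simp only [Function.update_of_ne hi]
    split_ifs <;> ring

theorem sum_Icc_one_sub (f : ℕ → ℝ) {k l : ℕ} (h : k ≤ l) :
    ∑ j ∈ Finset.Icc 1 l, f j - ∑ j ∈ Finset.Icc 1 k, f j = ∑ j ∈ Finset.Icc (k + 1) l, f j := by
  have hd : Finset.Icc 1 l \ Finset.Icc 1 k = Finset.Icc (k + 1) l := by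
    ext j; simp only [Finset.mem_sdiff, Finset.mem_Icc]; omega
  rw [← hd, ← Finset.sum_sdiff (Finset.Icc_subset_Icc_right h), add_sub_cancel_right]

/-- the marginal utility of adding a set `S` of blocks (with
pairwise distinct password indices, `I` being the set of indices and the block
for `i ∈ I` being `ϖ_i(τ i + 1, σ i)`) equals the sum of the individual marginal
utilities plus the cost-reduction terms. -/
theorem statement2 (P : Params) (hP : P.Hyp) (τ : ℕ → ℕ) (hτ : P.Valid τ)
    (I : Finset ℕ) (hI : I ⊆ Finset.Icc 1 P.n) (σ : ℕ → ℕ)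
    (hadd : ∀ i ∈ I, τ i < σ i ∧ σ i ≤ P.m) :
    P.U (fun i => if i ∈ I then σ i else τ i) - P.U τ =
      (∑ i ∈ I, (P.U (Function.update τ i (σ i)) - P.U τ)) +
        ∑ i ∈ I, (∑ j ∈ Finset.Icc (τ i + 1) (σ i), P.rc j) *
          ∑ i' ∈ I.filter fun i'' => i'' < i, P.p i' * (P.Q (σ i') - P.Q (τ i')) := by
  clear hτ hP
  induction I using Finset.induction_on_max with
  | empty => simp
  | insert a I hlt ih =>
    have haI : a ∉ I := fun h => lt_irrefl a (hlt a h)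
    have ha := hI (Finset.mem_insert_self a I)
    have hI' : I ⊆ Finset.Icc 1 P.n := (Finset.subset_insert a I).trans hI
    have ih := ih hI' fun i hi => hadd i (Finset.mem_insert_of_mem hi)
    set τ' : ℕ → ℕ := fun i => if i ∈ I then σ i else τ i with hτ'
    have hup : (fun i => if i ∈ insert a I then σ i else τ i) = Function.update τ' a (σ a) := by
      ext i
      by_cases hi : i = a
      · subst hi; simp
      · simp [hi, hτ']
    have hτa : τ' a = τ a := by simp [hτ', haI]
    have hfa : (insert a I).filter (fun i => i < a) = I := by
      ext i
      simp only [Finset.mem_filter, Finset.mem_insert]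
      exact ⟨fun h => h.1.resolve_left h.2.ne, fun h => ⟨Or.inr h, hlt i h⟩⟩
    have hfi : ∀ i ∈ I, (insert a I).filter (fun k => k < i) = I.filter fun k => k < i := by
      intro i hi
      rw [Finset.filter_insert, if_neg (hlt i hi).le.not_gt]
    have hsum : ∑ i ∈ Finset.Ico 1 a, P.p i * P.Q (τ' i) =
        ∑ i ∈ Finset.Ico 1 a, P.p i * P.Q (τ i) +
          ∑ i ∈ I, P.p i * (P.Q (σ i) - P.Q (τ i)) := by
      have hsub : I ⊆ Finset.Ico 1 a := fun i hi =>
        Finset.mem_Ico.mpr ⟨(Finset.mem_Icc.mp (hI' hi)).1, hlt i hi⟩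
      have hite := Finset.sum_ite_mem (Finset.Ico 1 a) I
        fun i => P.p i * (P.Q (σ i) - P.Q (τ i))
      rw [Finset.inter_eq_right.mpr hsub] at hite
      rw [← hite, ← Finset.sum_add_distrib]
      refine Finset.sum_congr rfl fun i _ => ?_
      simp only [hτ']
      split_ifs <;> ring
    have htail : ∀ d : ℝ, (∑ i ∈ Finset.Icc 1 P.n,
          if a < i then (∑ j ∈ Finset.Icc 1 (τ' i), P.rc j) * d else 0) =
        ∑ i ∈ Finset.Icc 1 P.n, if a < i then (∑ j ∈ Finset.Icc 1 (τ i), P.rc j) * d else 0 := by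
      intro d
      refine Finset.sum_congr rfl fun i _ => ?_
      split_ifs with h
      · have : i ∉ I := fun hi => (hlt i hi).not_gt h
        simp [hτ', this]
      · rfl
    have hstep : P.U (Function.update τ' a (σ a)) - P.U τ' =
        P.U (Function.update τ a (σ a)) - P.U τ +
          (∑ j ∈ Finset.Icc (τ a + 1) (σ a), P.rc j) *
            ∑ i ∈ I, P.p i * (P.Q (σ i) - P.Q (τ i)) := by
      rw [U_update_sub P τ' ha, U_update_sub P τ ha, hτa, hsum, htail,
        ← sum_Icc_one_sub P.rc (hadd a (Finset.mem_insert_self a I)).1.le]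
      ring
    have hcost : ∑ i ∈ I, (∑ j ∈ Finset.Icc (τ i + 1) (σ i), P.rc j) *
          ∑ k ∈ (insert a I).filter fun k => k < i, P.p k * (P.Q (σ k) - P.Q (τ k)) =
        ∑ i ∈ I, (∑ j ∈ Finset.Icc (τ i + 1) (σ i), P.rc j) *
          ∑ k ∈ I.filter fun k => k < i, P.p k * (P.Q (σ k) - P.Q (τ k)) :=
      Finset.sum_congr rfl fun i hi => by rw [hfi i hi]
    rw [hup, Finset.sum_insert haI, Finset.sum_insert haI, hfa, hcost]
    linear_combination hstep + ih

end Params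
end
end

section
/- Let π_LOC be any output of the greedy concatenation algorithm and ℓ(σ) := max{i : τ_i(σ) ≥ 1} (with ℓ(σ) = 0 for the empty sequence). Then ℓ(π_LOC) ≤ i_max, and there exists an optimal checking sequence π* with ℓ(π_LOC) ≤ ℓ(π*) ≤ i_max. -/
noncomputable section

namespace Params

/-- `Π(l)`: the checking sequence fully checking the top `l` passwords
(`τ i = m` for `i ≤ l` and `τ i = 0` for `i > l`). -/
def Pifull (P : Params) (l : ℕ) : ℕ → ℕ := fun i => if 1 ≤ i ∧ i ≤ l then P.m else 0

/-- `F i`: the best marginal utility of appending a block `ϖ_i(1, j)`,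
`1 ≤ j ≤ m`, to `Π(i - 1)`. -/
def F (P : Params) (i : ℕ) : ℝ :=
  sSup ((fun j => P.U (Function.update (P.Pifull (i - 1)) i j) - P.U (P.Pifull (i - 1))) ''
    Set.Icc 1 P.m)

/-- `i_max`: the largest `i ∈ [1, n]` with `F i ≥ 0`, or `0` if there is none. -/
def imax (P : Params) : ℕ := sSup {i | i ∈ Finset.Icc 1 P.n ∧ 0 ≤ P.F i}

/-- Truncation of an exponent vector to the first `k` passwords. -/
def truncSeq (τ : ℕ → ℕ) (k : ℕ) : ℕ → ℕ := fun i => if i ≤ k then τ i else 0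

/-- `τ` is a possible output of the greedy concatenation algorithm: for
`i = 1, 2, ...` the algorithm appends a block `ϖ_i(1, τ i)` with `τ i ∈ [0, m]`
maximizing the marginal utility upon concatenation, stopping the first time the
chosen exponent is `0`. -/
def GreedyOutput (P : Params) (τ : ℕ → ℕ) : Prop :=
  P.Valid τ ∧
    ∃ l ≤ P.n,
      (∀ i, 1 ≤ i → i ≤ l → 1 ≤ τ i) ∧
      (∀ i, l < i → τ i = 0) ∧
      (∀ i, 1 ≤ i → i ≤ l → ∀ j ≤ P.m,
        P.U (Function.update (truncSeq τ (i - 1)) i j) ≤ P.U (truncSeq τ i)) ∧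
      (l < P.n → ∀ j, 1 ≤ j → j ≤ P.m → P.U (Function.update τ (l + 1) j) ≤ P.U τ)

/-- `ℓ(σ) = max {i : τ i ≥ 1}` (and `0` for the empty checking sequence). -/
def lenSeq (τ : ℕ → ℕ) : ℕ := sSup {i | 1 ≤ τ i}

theorem Q_zero (P : Params) : P.Q 0 = 0 := by simp [Q]

theorem Q_le_Q {P : Params} (hP : P.Hyp) {a b : ℕ} (hab : a ≤ b) (hb : b ≤ P.m) :
    P.Q a ≤ P.Q b := by
  refine Finset.sum_le_sum_of_subset_of_nonneg (Finset.Icc_subset_Icc_right hab) ?_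
  intro j hj _
  rw [Finset.mem_Icc] at hj
  exact hP.q_nonneg j (Finset.mem_Icc.2 ⟨hj.1, hj.2.trans hb⟩)

/-- Total round cost of executing the first `j` instructions of a password. -/
def cumCost (P : Params) (j : ℕ) : ℝ := ∑ j' ∈ Finset.Icc 1 j, P.rc j'

theorem rc_nonneg {P : Params} (hP : P.Hyp) {j : ℕ} (h1 : 1 ≤ j) (hj : j ≤ P.m) :
    0 ≤ P.rc j := by
  have h0 : 0 ≤ P.t (j - 1) := by
    rcases Nat.eq_zero_or_pos (j - 1) with h | h
    · rw [h, hP.t_zero]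
    · rw [← hP.t_zero]
      exact (hP.t_mono 0 (j - 1) h (by omega)).le
  have h2 : P.t (j - 1) < P.t j := hP.t_mono (j - 1) j (by omega) hj
  exact mul_nonneg hP.cM_pos.le (by nlinarith)

theorem cumCost_le_cumCost {P : Params} (hP : P.Hyp) {a b : ℕ} (hab : a ≤ b) (hb : b ≤ P.m) :
    P.cumCost a ≤ P.cumCost b := by
  refine Finset.sum_le_sum_of_subset_of_nonneg (Finset.Icc_subset_Icc_right hab) ?_
  intro j hj _
  rw [Finset.mem_Icc] at hj
  exact rc_nonneg hP hj.1 (hj.2.trans hb)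

theorem cumCost_nonneg {P : Params} (hP : P.Hyp) {j : ℕ} (hj : j ≤ P.m) : 0 ≤ P.cumCost j := by
  simpa [cumCost] using cumCost_le_cumCost hP (Nat.zero_le j) hj

/-- Probability mass of the blocks of `τ` preceding password `i`. -/
def massBefore (P : Params) (τ : ℕ → ℕ) (i : ℕ) : ℝ :=
  ∑ i' ∈ Finset.Ico 1 i, P.p i' * P.Q (τ i')

/-- Marginal utility of appending the block `ϖ_i(1, j)` to a checking sequence of mass `S`
on the passwords before `i`. -/
def gain (P : Params) (S : ℝ) (i j : ℕ) : ℝ :=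
  P.p i * (P.v * P.Q j + ∑ j' ∈ Finset.Icc 1 j, P.rc j' * P.Q (j' - 1)) - P.cumCost j * (1 - S)

theorem gain_zero (P : Params) (S : ℝ) (i : ℕ) : P.gain S i 0 = 0 := by
  simp [gain, Q_zero, cumCost]

theorem gain_mono {P : Params} (hP : P.Hyp) {S S' : ℝ} (hS : S ≤ S') (i : ℕ) {j : ℕ}
    (hj : j ≤ P.m) : P.gain S i j ≤ P.gain S' i j := by
  have := mul_le_mul_of_nonneg_left hS (cumCost_nonneg hP hj)
  unfold gain
  linarith

/-- The gain has increasing differences in the preceding mass and the block length. -/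
theorem gain_sub_gain_mono {P : Params} (hP : P.Hyp) {S S' : ℝ} (hS : S ≤ S') (i : ℕ) {j j' : ℕ}
    (hjj' : j ≤ j') (hj' : j' ≤ P.m) :
    P.gain S i j' - P.gain S i j ≤ P.gain S' i j' - P.gain S' i j := by
  have := mul_le_mul_of_nonneg_left hS (sub_nonneg.2 (cumCost_le_cumCost hP hjj' hj'))
  unfold gain
  linarith

theorem massBefore_mono {P : Params} (hP : P.Hyp) {τ σ : ℕ → ℕ} {i : ℕ} (hi : i ≤ P.n)
    (hle : ∀ k, 1 ≤ k → k < i → τ k ≤ σ k) (hσ : ∀ k, σ k ≤ P.m) :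
    P.massBefore τ i ≤ P.massBefore σ i := by
  refine Finset.sum_le_sum fun k hk => ?_
  rw [Finset.mem_Ico] at hk
  exact mul_le_mul_of_nonneg_left (Q_le_Q hP (hle k hk.1 hk.2) (hσ k))
    (hP.p_pos k (Finset.mem_Icc.2 ⟨hk.1, by omega⟩)).le

theorem massBefore_congr (P : Params) {τ σ : ℕ → ℕ} {i : ℕ} (h : ∀ k < i, τ k = σ k) :
    P.massBefore τ i = P.massBefore σ i :=
  Finset.sum_congr rfl fun k hk => by rw [h k (Finset.mem_Ico.1 hk).2]

theorem U_eq_sum_gain (P : Params) (τ : ℕ → ℕ) :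
    P.U τ = ∑ i ∈ Finset.Icc 1 P.n, P.gain (P.massBefore τ i) i (τ i) := by
  rw [U, lam, Finset.mul_sum, ← Finset.sum_sub_distrib]
  refine Finset.sum_congr rfl fun i _ => ?_
  have h : ∑ j ∈ Finset.Icc 1 (τ i), P.rc j * (1 - P.lamBefore τ i j) =
      P.cumCost (τ i) * (1 - P.massBefore τ i) -
        P.p i * ∑ j ∈ Finset.Icc 1 (τ i), P.rc j * P.Q (j - 1) := by
    rw [cumCost, Finset.sum_mul, Finset.mul_sum, ← Finset.sum_sub_distrib]
    refine Finset.sum_congr rfl fun j _ => ?_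
    simp only [lamBefore, massBefore]
    ring
  rw [h, gain]
  ring

/-- Changing the last block of a checking sequence changes the utility by the difference of
the gains. -/
theorem U_update_sub_s5 (P : Params) {τ : ℕ → ℕ} {i : ℕ} (h1 : 1 ≤ i) (hi : i ≤ P.n)
    (hτ : ∀ k, i < k → τ k = 0) (j : ℕ) :
    P.U (Function.update τ i j) - P.U τ =
      P.gain (P.massBefore τ i) i j - P.gain (P.massBefore τ i) i (τ i) := by
  rw [U_eq_sum_gain, U_eq_sum_gain, ← Finset.sum_sub_distrib,
    Finset.sum_eq_single_of_mem i (Finset.mem_Icc.2 ⟨h1, hi⟩)]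
  · rw [Function.update_self, massBefore_congr P (σ := τ)]
    exact fun k hk => Function.update_of_ne hk.ne _ _
  · intro k _ hki
    rw [Function.update_of_ne hki]
    rcases lt_or_gt_of_ne hki with h | h
    · rw [massBefore_congr P (σ := τ), sub_self]
      exact fun k' hk' => Function.update_of_ne (by omega) _ _
    · simp [hτ k h, gain_zero]

theorem le_imax {P : Params} (hP : P.Hyp) {τ : ℕ → ℕ} (hτ : P.Valid τ) {i : ℕ}
    (hi : 1 ≤ τ i) (hg : 0 ≤ P.gain (P.massBefore τ i) i (τ i)) : i ≤ P.imax := by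
  have hin : i ∈ Finset.Icc 1 P.n := by
    by_contra h
    have := hτ.2 i h
    omega
  obtain ⟨h1, hn⟩ := Finset.mem_Icc.1 hin
  refine le_csSup ⟨P.n, fun k hk => (Finset.mem_Icc.1 hk.1).2⟩ ⟨hin, ?_⟩
  have hmass : P.massBefore τ i ≤ P.massBefore (P.Pifull (i - 1)) i := by
    refine massBefore_mono hP hn (fun k hk hki => ?_) fun k => ?_
    · rw [Pifull, if_pos ⟨hk, by omega⟩]
      exact hτ.1 k
    · unfold Pifull
      split_ifs <;> omega
  have hF : P.U (Function.update (P.Pifull (i - 1)) i (τ i)) - P.U (P.Pifull (i - 1)) ≤ P.F i :=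
    le_csSup ((Set.finite_Icc 1 P.m).image _).bddAbove ⟨τ i, ⟨hi, hτ.1 i⟩, rfl⟩
  have hvan : ∀ k, i < k → P.Pifull (i - 1) k = 0 := fun k hk => if_neg (by omega)
  rw [U_update_sub_s5 P h1 hn hvan,
    show P.Pifull (i - 1) i = 0 from if_neg (by omega), gain_zero, sub_zero] at hF
  exact hg.trans ((gain_mono hP hmass i (hτ.1 i)).trans hF)

theorem GreedyOutput.gain_le {P : Params} {τ : ℕ → ℕ} (h : P.GreedyOutput τ) {i : ℕ}
    (hi : 1 ≤ τ i) {j : ℕ} (hj : j ≤ P.m) :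
    P.gain (P.massBefore τ i) i j ≤ P.gain (P.massBefore τ i) i (τ i) := by
  obtain ⟨hτ, l, hl, -, hzero, hmax, -⟩ := h
  have hil : i ≤ l := by
    by_contra hcon
    have := hzero i (by omega)
    omega
  have h1 : 1 ≤ i := by
    by_contra hcon
    have := hτ.2 i (by simp; omega)
    omega
  have hin : i ≤ P.n := hil.trans hl
  have htr : truncSeq τ i = Function.update (truncSeq τ (i - 1)) i (τ i) := by
    funext k
    by_cases hk : k = i
    · subst hk
      simp [truncSeq]
    · rw [Function.update_of_ne hk]
      simp only [truncSeq]
      congr 1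
      simp only [eq_iff_iff]
      omega
  have hmass : P.massBefore (truncSeq τ (i - 1)) i = P.massBefore τ i :=
    massBefore_congr P fun k hk => if_pos (by omega)
  have hvan : ∀ k, i < k → truncSeq τ (i - 1) k = 0 := fun k hk => if_neg (by omega)
  have hle := hmax i h1 hil j hj
  have hj' := U_update_sub_s5 P h1 hin hvan j
  have hτ' := U_update_sub_s5 P h1 hin hvan (τ i)
  rw [hmass] at hj' hτ'
  rw [htr] at hle
  linarith

theorem finite_setOf_valid (P : Params) : {τ | P.Valid τ}.Finite := by
  refine (Set.finite_range fun (f : Fin (P.n + 1) → Fin (P.m + 1)) (i : ℕ) =>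
    if h : i < P.n + 1 then (f ⟨i, h⟩ : ℕ) else 0).subset ?_
  rintro τ (hτ : P.Valid τ)
  refine ⟨fun i => ⟨τ i, Nat.lt_succ_of_le (hτ.1 i)⟩, ?_⟩
  funext i
  by_cases h : i < P.n + 1
  · simp [h]
  · simp [h, hτ.2 i (by simp; omega)]

theorem exists_optimal (P : Params) : ∃ τ, P.Optimal τ := by
  obtain ⟨τ, hτ, hmax⟩ := Set.exists_max_image {τ | P.Valid τ} P.U P.finite_setOf_valid
    ⟨fun _ => 0, fun _ => Nat.zero_le _, fun _ _ => rfl⟩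
  exact ⟨τ, hτ, hmax⟩

theorem Valid.bddAbove {P : Params} {τ : ℕ → ℕ} (hτ : P.Valid τ) : BddAbove {i | 1 ≤ τ i} := by
  refine ⟨P.n, fun i hi => ?_⟩
  by_contra h
  have h0 := hτ.2 i (by simp; omega)
  have h1 : 1 ≤ τ i := hi
  omega

theorem Optimal.lenSeq_le_imax {P : Params} (hP : P.Hyp) {τ : ℕ → ℕ} (h : P.Optimal τ) :
    lenSeq τ ≤ P.imax := by
  obtain ⟨hτ, hmax⟩ := h
  rcases Set.eq_empty_or_nonempty {i | 1 ≤ τ i} with he | hne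
  · simp [lenSeq, he]
  have hi : 1 ≤ τ (lenSeq τ) := Nat.sSup_mem hne hτ.bddAbove
  have hvan : ∀ k, lenSeq τ < k → τ k = 0 := by
    intro k hk
    by_contra hcon
    have : k ≤ lenSeq τ := le_csSup hτ.bddAbove (Nat.one_le_iff_ne_zero.2 hcon)
    omega
  have hin : lenSeq τ ∈ Finset.Icc 1 P.n := by
    by_contra hcon
    have := hτ.2 _ hcon
    omega
  obtain ⟨h1, hn⟩ := Finset.mem_Icc.1 hin
  refine le_imax hP hτ hi ?_
  have hU := U_update_sub_s5 P h1 hn hvan 0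
  have hle := hmax (Function.update τ (lenSeq τ) 0) ⟨fun k => ?_, fun k hk => ?_⟩
  · rw [gain_zero] at hU
    linarith
  · rw [Function.update_apply]
    split_ifs
    exacts [Nat.zero_le _, hτ.1 k]
  · rw [Function.update_apply, hτ.2 k hk, ite_self]

/-- Joining an optimal checking sequence with a greedy one preserves optimality. -/
theorem Optimal.sup_greedyOutput {P : Params} (hP : P.Hyp) {τ σ : ℕ → ℕ} (hσ : P.Optimal σ)
    (hτ : P.GreedyOutput τ) : P.Optimal (τ ⊔ σ) := by
  have hm : ∀ k, (τ ⊔ σ) k ≤ P.m := fun k => sup_le (hτ.1.1 k) (hσ.1.1 k)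
  refine ⟨⟨hm, fun k hk => by simp [hτ.1.2 k hk, hσ.1.2 k hk]⟩,
    fun τ' hτ' => (hσ.2 τ' hτ').trans ?_⟩
  rw [U_eq_sum_gain, U_eq_sum_gain]
  refine Finset.sum_le_sum fun i hi => ?_
  have hin := (Finset.mem_Icc.1 hi).2
  have hSσ : P.massBefore σ i ≤ P.massBefore (τ ⊔ σ) i :=
    massBefore_mono hP hin (fun k _ _ => le_sup_right) hm
  have hSτ : P.massBefore τ i ≤ P.massBefore (τ ⊔ σ) i :=
    massBefore_mono hP hin (fun k _ _ => le_sup_left) hm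
  refine (gain_mono hP hSσ i (hσ.1.1 i)).trans ?_
  rw [Pi.sup_apply]
  rcases le_or_gt (τ i) (σ i) with h | h
  · rw [sup_eq_right.2 h]
  · rw [sup_eq_left.2 h.le]
    have hdiff := gain_sub_gain_mono hP hSτ i h.le (hτ.1.1 i)
    have hgreedy := hτ.gain_le (by omega : 1 ≤ τ i) (hσ.1.1 i)
    linarith

/-- `ℓ(π_LOC) ≤ i_max` and there is an optimal checking sequence
`π*` with `ℓ(π_LOC) ≤ ℓ(π*) ≤ i_max`. -/
theorem statement5 (P : Params) (hP : P.Hyp) (τ : ℕ → ℕ) (hgr : P.GreedyOutput τ) :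
    lenSeq τ ≤ P.imax ∧
      ∃ τs, P.Optimal τs ∧ lenSeq τ ≤ lenSeq τs ∧ lenSeq τs ≤ P.imax := by
  obtain ⟨σ, hσ⟩ := P.exists_optimal
  have hopt := hσ.sup_greedyOutput hP hgr
  have hlen : lenSeq τ ≤ lenSeq (τ ⊔ σ) :=
    csSup_le_csSup' hopt.1.bddAbove fun i (hi : 1 ≤ τ i) => hi.trans le_sup_left
  have himax := hopt.lenSeq_le_imax hP
  exact ⟨hlen.trans himax, τ ⊔ σ, hopt, hlen, himax⟩

end Params
end
end

section
/- Let n = 2, p₁ = p₂ = 1/2, and v = 3/2 − ε with 0 < ε < 1/10. (a) In the deterministic model m = 1 with c_M·t₁² = 1, every nonempty checking sequence π satisfies U(π) < 0; hence the empty sequence is the unique optimal checking sequence and λ(π*) = 0. (b) In the time-even model m = 2 with q₁ = q₂ = 1/2, t₂ = 2·t₁, and c_M·t₁² = 2/5 (so that the expected evaluation cost q₁·c_M·t₁² + q₂·c_M·t₂² equals 1), the checking sequence with exponents τ₁ = τ₂ = 1 has utility 1/20 − ε/2 > 0; consequently every optimal checking sequence π* is nonempty and satisfies λ(π*) ≥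 1/4. -/
noncomputable section

namespace Params

theorem Q_one (P : Params) : P.Q 1 = P.q 1 := by
  simp [Q]

theorem Q_two (P : Params) : P.Q 2 = P.q 1 + P.q 2 := by
  simp [Q, Finset.sum_Icc_succ_top]

theorem lam_two {P : Params} (hn : P.n = 2) (τ : ℕ → ℕ) :
    P.lam τ = P.p 1 * P.Q (τ 1) + P.p 2 * P.Q (τ 2) := by
  simp [lam, hn, Finset.sum_Icc_succ_top]

theorem U_two {P : Params} (hn : P.n = 2) (τ : ℕ → ℕ) :
    P.U τ = P.v * (P.p 1 * P.Q (τ 1) + P.p 2 * P.Q (τ 2)) -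
      (∑ j ∈ Finset.Icc 1 (τ 1), P.rc j * (1 - P.p 1 * P.Q (j - 1)) +
        ∑ j ∈ Finset.Icc 1 (τ 2),
          P.rc j * (1 - (P.p 1 * P.Q (τ 1) + P.p 2 * P.Q (j - 1)))) := by
  simp [U, lam_two hn, lamBefore, hn, Finset.sum_Icc_succ_top]

theorem U_zero (P : Params) : P.U (fun _ => 0) = 0 := by
  simp [U, lam, Q_zero]

/-- With two passwords, a valid exponent vector vanishes as soon as its first two entries do. -/
theorem Valid.eq_zero {P : Params} {τ : ℕ → ℕ} (hτ : P.Valid τ) (hn : P.n = 2)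
    (h1 : τ 1 = 0) (h2 : τ 2 = 0) (i : ℕ) : τ i = 0 := by
  by_cases hi : i ∈ Finset.Icc 1 P.n
  · rw [hn, Finset.mem_Icc] at hi
    obtain rfl | rfl : i = 1 ∨ i = 2 := by omega
    · exact h1
    · exact h2
  · exact hτ.2 i hi

theorem valid_zero (P : Params) : P.Valid (fun _ => 0) :=
  ⟨fun _ => Nat.zero_le _, fun _ _ => rfl⟩

/-- the contrived two-password example. (a) Under deterministic
hashing (`m = 1`, cost `1`) every nonempty checking sequence has negative
utility, the empty sequence is the unique optimal one, and the attacker cracks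
no password. (b) Under time-even breakpoints (`m = 2`, `t₂ = 2·t₁`,
`cM·t₁² = 2/5`, uniform `q`), checking the first label of both passwords has
utility `1/20 - ε/2 > 0`, so every optimal checking sequence is nonempty and
cracks a password with probability at least `1/4`. -/
theorem statement18 (ε : ℝ) (hε0 : 0 < ε) (hε1 : ε < 1 / 10)
    (Pa : Params) (hPa : Pa.Hyp)
    (han : Pa.n = 2) (ham : Pa.m = 1) (hap1 : Pa.p 1 = 1 / 2) (hap2 : Pa.p 2 = 1 / 2)
    (hav : Pa.v = 3 / 2 - ε) (haq : Pa.q 1 = 1) (hac : Pa.cM * Pa.t 1 ^ 2 = 1)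
    (Pb : Params) (hPb : Pb.Hyp)
    (hbn : Pb.n = 2) (hbm : Pb.m = 2) (hbp1 : Pb.p 1 = 1 / 2) (hbp2 : Pb.p 2 = 1 / 2)
    (hbv : Pb.v = 3 / 2 - ε) (hbq1 : Pb.q 1 = 1 / 2) (hbq2 : Pb.q 2 = 1 / 2)
    (hbt : Pb.t 2 = 2 * Pb.t 1) (hbc : Pb.cM * Pb.t 1 ^ 2 = 2 / 5) :
    ((∀ τ, Pa.Valid τ → (∃ i, 1 ≤ τ i) → Pa.U τ < 0) ∧
        Pa.Optimal (fun _ => 0) ∧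
        (∀ τ, Pa.Optimal τ → ∀ i, τ i = 0) ∧
        (∀ τ, Pa.Optimal τ → Pa.lam τ = 0)) ∧
      (Pb.U (fun i => if 1 ≤ i ∧ i ≤ 2 then 1 else 0) = 1 / 20 - ε / 2 ∧
        (0 : ℝ) < 1 / 20 - ε / 2 ∧
        ∀ τ, Pb.Optimal τ → (∃ i, 1 ≤ τ i) ∧ 1 / 4 ≤ Pb.lam τ) := by
  have hrc : Pa.rc 1 = 1 := by simp [rc, hPa.t_zero, hac]
  have hneg : ∀ τ, Pa.Valid τ → (∃ i, 1 ≤ τ i) → Pa.U τ < 0 := by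
    rintro τ hτ ⟨i, hi⟩
    have h1 : τ 1 ≤ 1 := ham ▸ hτ.1 1
    have h2 : τ 2 ≤ 1 := ham ▸ hτ.1 2
    have hne : ¬(τ 1 = 0 ∧ τ 2 = 0) := fun h => by
      have := hτ.eq_zero han h.1 h.2 i
      omega
    rw [U_two han]
    interval_cases τ 1 <;> interval_cases τ 2 <;>
      simp [Q_zero, Q_one, hrc, hap1, hap2, hav, haq] at hne ⊢ <;> linarith
  have hopt : ∀ τ, Pa.Optimal τ → ∀ i, τ i = 0 := by
    intro τ hτ i
    by_contra hi
    have hlt := hneg τ hτ.1 ⟨i, Nat.one_le_iff_ne_zero.2 hi⟩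
    have hle := hτ.2 _ Pa.valid_zero
    rw [U_zero] at hle
    linarith
  have hU : Pb.U (fun i => if 1 ≤ i ∧ i ≤ 2 then 1 else 0) = 1 / 20 - ε / 2 := by
    have hrc' : Pb.rc 1 = 2 / 5 := by simp [rc, hPb.t_zero, hbc]
    simp [U_two hbn, Q_zero, Q_one, hrc', hbp1, hbp2, hbv, hbq1]
    ring
  have hpos : (0 : ℝ) < 1 / 20 - ε / 2 := by linarith
  refine ⟨⟨hneg, ⟨Pa.valid_zero, fun τ hτ => ?_⟩, hopt, fun τ hτ => ?_⟩, hU, hpos,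
    fun τ hτ => ?_⟩
  · rw [U_zero]
    by_cases h : ∃ i, 1 ≤ τ i
    · exact (hneg τ hτ h).le
    · obtain rfl : τ = fun _ => 0 := by
        funext i
        by_contra hi
        exact h ⟨i, Nat.one_le_iff_ne_zero.2 hi⟩
      exact Pa.U_zero.le
  · simp [lam_two han, hopt τ hτ, Q_zero]
  · have hle := hτ.2 (fun i => if 1 ≤ i ∧ i ≤ 2 then 1 else 0)
      ⟨fun i => by dsimp only; split_ifs <;> omega, fun i hi => by
        rw [hbn, Finset.mem_Icc] at hi
        exact if_neg hi⟩
    have hne : ¬(τ 1 = 0 ∧ τ 2 = 0) := fun h => by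
      obtain rfl : τ = fun _ => 0 := funext (hτ.1.eq_zero hbn h.1 h.2)
      rw [hU, U_zero] at hle
      linarith
    refine ⟨?_, ?_⟩
    · by_contra! h
      exact hne ⟨Nat.lt_one_iff.1 (h 1), Nat.lt_one_iff.1 (h 2)⟩
    · have h1 : τ 1 ≤ 2 := hbm ▸ hτ.1.1 1
      have h2 : τ 2 ≤ 2 := hbm ▸ hτ.1.1 2
      rw [lam_two hbn, hbp1, hbp2]
      interval_cases τ 1 <;> interval_cases τ 2 <;>
        simp [Q_zero, Q_one, Q_two, hbq1, hbq2] at hne ⊢ <;> norm_num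

end Params
end
end
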